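/- Let an SSSCG have weakly monotonic cost functions with c_{i,ℓ} = c_{i,f} =: c_i for every i ∈ R. Let σ_ℓ be the pure leader strategy on a resource i* and let ν ∈ E^{σ_ℓ}. Suppose there is no pure leader strategy σ̂_ℓ such that every ν̂ ∈ E^{σ̂_ℓ} satisfies c_ℓ^{(σ̂_ℓ,ν̂)} < c_ℓ^{(σ_ℓ,ν)} (this holds in particular if (σ_ℓ,ν) is an optimistic or a pessimistic Stackelberg equilibrium). Then c_{i*}(ν_{i*} + 1) ≤ c_j(ν_j + 1) for every j ∈ R, so the profile of the (|F|+1)-player singleton congestion game in which the leader plays i* and the followers are distributed according to ν is a Nash equilibrium: neither the leader nor any follower can strictly decrease her cost by unilaterally switching resource. -/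

import Mathlib

open Finset

/-- A leader strategy: a probability distribution over the resources. -/
def IsStrategy {R : Type} [Fintype R] (σ : R → ℚ) : Prop :=
  (∀ i, 0 ≤ σ i) ∧ ∑ i, σ i = 1

/-- A followers' configuration: `nF` followers distributed over the resources. -/
def IsConfig {R : Type} [Fintype R] (nF : ℕ) (ν : R → ℕ) : Prop :=
  ∑ i, ν i = nF

/-- Followers' expected cost of a resource with cost function `c`, selected by the leader
with probability `p`, when `x` followers select it. -/
def expCost (c : ℕ → ℚ) (p : ℚ) (x : ℕ) : ℚ := p * c (x + 1) + (1 - p) * c x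

/-- `ν` is a Nash equilibrium of the followers' game induced by the leader's strategy `σ`. -/
def IsNE {R : Type} [Fintype R] (cf : R → ℕ → ℚ) (σ : R → ℚ) (ν : R → ℕ) : Prop :=
  ∀ i j, i ≠ j → 0 < ν i → expCost (cf i) (σ i) (ν i) ≤ expCost (cf j) (σ j) (ν j + 1)

/-- The leader's expected cost. -/
def leaderCost {R : Type} [Fintype R] (cl : R → ℕ → ℚ) (σ : R → ℚ) (ν : R → ℕ) : ℚ :=
  ∑ i, σ i * cl i (ν i + 1)

/-- The pure leader strategy on resource `i`. -/
def pureStrat {R : Type} [DecidableEq R] (i : R) : R → ℚ := fun j => if j = i then 1 else 0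

theorem expCost_pureStrat {R : Type} [DecidableEq R] (c : ℕ → ℚ) (k i : R) (x : ℕ) :
    expCost c (pureStrat k i) x = c (x + if i = k then 1 else 0) := by
  by_cases h : i = k <;> simp [expCost, pureStrat, h]

theorem leaderCost_pureStrat {R : Type} [Fintype R] [DecidableEq R] (c : R → ℕ → ℚ) (k : R)
    (ν : R → ℕ) : leaderCost c (pureStrat k) ν = c k (ν k + 1) := by
  simp [leaderCost, pureStrat]

theorem isNE_pureStrat_iff {R : Type} [Fintype R] [DecidableEq R] (c : R → ℕ → ℚ) (k : R)
    (ν : R → ℕ) : IsNE c (pureStrat k) ν ↔ ∀ i j, i ≠ j → 0 < ν i →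
      c i (ν i + if i = k then 1 else 0) ≤ c j (ν j + (if j = k then 1 else 0) + 1) := by
  simp only [IsNE, expCost_pureStrat, Nat.add_right_comm _ 1]

/-- Two configurations of equally many followers: if one uses a resource more, it uses another
one less. -/
theorem IsConfig.exists_lt_of_lt {R : Type} [Fintype R] {nF : ℕ} {ν μ : R → ℕ}
    (hν : IsConfig nF ν) (hμ : IsConfig nF μ) {j : R} (hj : ν j < μ j) : ∃ k, μ k < ν k := by
  by_contra! hle
  have hlt : ∑ i, ν i < ∑ i, μ i :=
    Finset.sum_lt_sum (fun i _ => hle i) ⟨j, Finset.mem_univ j, hj⟩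
  rw [hν, hμ] at hlt
  exact hlt.false

/-- In an SSSCG with weakly monotonic costs and identical leader's and followers' cost
functions `c`, if the pure commitment on `i*` together with an NE `ν` for it is not
strictly dominated (for every induced NE) by any other pure commitment — as is the case at
any optimistic or pessimistic Stackelberg equilibrium with pure leader's strategy — then
`c_{i*}(ν_{i*}+1) ≤ c_j(ν_j+1)` for every `j`, and the profile of the `(|F|+1)`-player
singleton congestion game in which the leader plays `i*` and the followers are distributed
according to `ν` is a Nash equilibrium (of the game without leadership). -/
theorem stmt10 {R : Type} [Fintype R] [DecidableEq R] (nF : ℕ)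
    (c : R → ℕ → ℚ) (h0 : ∀ i, c i 0 = 0) (hmono : ∀ i x, c i x ≤ c i (x + 1))
    (istar : R) (ν : R → ℕ) (hν : IsConfig nF ν)
    (hNE : IsNE c (pureStrat istar) ν)
    (hnodom : ¬ ∃ jhat : R, ∀ νh : R → ℕ, IsConfig nF νh → IsNE c (pureStrat jhat) νh →
        leaderCost c (pureStrat jhat) νh < leaderCost c (pureStrat istar) ν) :
    -- the leader cannot strictly decrease her cost by unilaterally switching resource
    (∀ j, c istar (ν istar + 1) ≤ c j (ν j + 1)) ∧
    -- nor can any follower (with the leader's presence on i* accounted for)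
    (∀ i j, i ≠ j → 0 < ν i →
      c i (ν i + (if i = istar then 1 else 0)) ≤
        c j (ν j + (if j = istar then 1 else 0) + 1)) := by
  rw [isNE_pureStrat_iff] at hNE
  refine ⟨fun j => ?_, hNE⟩
  by_contra! hlt
  have hj : j ≠ istar := by
    rintro rfl
    exact hlt.false
  have hstar : ν istar = 0 := by
    by_contra hpos
    have h := hNE istar j hj.symm (Nat.pos_of_ne_zero hpos)
    simp only [if_true, if_neg hj, add_zero] at h
    exact hlt.not_ge h
  refine hnodom ⟨j, fun μ hμ hμNE => ?_⟩
  rw [isNE_pureStrat_iff] at hμNE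
  simp only [leaderCost_pureStrat]
  by_contra! hge
  have hc : ∀ i, Monotone (c i) := fun i => monotone_nat_of_le_succ (hmono i)
  have hjμ : ν j < μ j := by
    by_contra! hle
    exact (hge.trans (hc j (Nat.succ_le_succ hle))).not_gt hlt
  obtain ⟨k, hk⟩ := hν.exists_lt_of_lt hμ hjμ
  have hkj : k ≠ j := by
    rintro rfl
    exact hk.not_gt hjμ
  have hkstar : k ≠ istar := by
    rintro rfl
    omega
  have h₁ := hμNE j k hkj.symm (by omega)
  have h₂ := hNE k j hkj (by omega)
  simp only [if_true, if_neg hkj, if_neg hkstar, if_neg hj, add_zero] at h₁ h₂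
  have h₃ : c k (μ k + 1) ≤ c k (ν k) := hc k hk
  linarith
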